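/- arXiv:2401.01449 — 6 statements merged into one kernel-verified Lean document; each statement's English description precedes it below -/
import Mathlib

section
/- For integers d ≥ 2, k ≥ 3 and n ≥ 1, the non-k-equal manifold M_d^(k)(n) is (d(k−1)−2)-connected: it is nonempty, path-connected, and for every basepoint x and every integer i with 1 ≤ i ≤ d(k−1)−2 the homotopy group π_i(M_d^(k)(n), x) is trivial. In particular M_d^(k)(n) is simply connected. -/
/-- The non-`k`-equal manifold `M_d^(k)(n)`: the complement in `(ℝ^d)^n` of the union of the
diagonal subspaces `A_I = {x : x_{i_1} = ⋯ = x_{i_k}}` over all `k`-element subsets `I` of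
`{1,…,n}`. -/
def nonKEqual (d k n : ℕ) : Set (Fin n → Fin d → ℝ) :=
  {x | ∀ I : Finset (Fin n), I.card = k → ∃ i ∈ I, ∃ j ∈ I, x i ≠ x j}

/-- The complement of a family of linear subspaces. -/
def arrangementCompl {E ι : Type*} [AddCommGroup E] [Module ℝ E] (V : ι → Submodule ℝ E) : Set E :=
  {x | ∀ j, x ∉ V j}

section Arrangement

open Module Set unitInterval

/-- Two maps into a subset of a vector space which are joined by segments inside the subset become
homotopic after composition with `r`, relative to any set on which `r` is constant along these
segments. -/
theorem ContinuousMap.homotopicRel_comp_of_segment {X E : Type*} [TopologicalSpace X]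
    [NormedAddCommGroup E] [NormedSpace ℝ E] {U : Set E}
    (r : C(U, U)) (f g : C(X, U)) (S : Set X)
    (hU : ∀ s, segment ℝ (f s : E) (g s) ⊆ U)
    (hS : ∀ s ∈ S, ∀ y : U, (y : E) ∈ segment ℝ (f s : E) (g s) → r y = r (f s)) :
    (r.comp f).HomotopicRel (r.comp g) S := by
  have hseg (t : I) (s : X) :
      AffineMap.lineMap (f s : E) (g s : E) (t : ℝ) ∈ segment ℝ (f s : E) (g s) := by
    rw [segment_eq_image_lineMap]
    exact ⟨t, t.2, rfl⟩
  refine ⟨{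
    toFun := fun z ↦ r ⟨AffineMap.lineMap (f z.2 : E) (g z.2 : E) (z.1 : ℝ), hU _ (hseg z.1 z.2)⟩
    continuous_toFun := by
      simp only [AffineMap.lineMap_apply_module]
      fun_prop
    map_zero_left := by simp
    map_one_left := by simp
    prop' := fun t s hs ↦ hS s hs _ (hseg t s) }⟩

variable {E ι : Type*} [NormedAddCommGroup E] [NormedSpace ℝ E] [FiniteDimensional ℝ E]
  [Finite ι] {V : ι → Submodule ℝ E}

/-- A generic point `p` can be joined to every point of the image of a `C¹` map by a segment
which avoids the subspaces `V j`, except possibly at its start. -/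
theorem dense_forall_segment_mem_arrangementCompl {F : Type*} [NormedAddCommGroup F]
    [NormedSpace ℝ F] [FiniteDimensional ℝ F]
    (hV : ∀ j, finrank ℝ (V j) + finrank ℝ F + 1 < finrank ℝ E) {g : F → E}
    (hg : ContDiff ℝ 1 g) :
    Dense {p : E | ∀ y, ∀ t : ℝ, 0 < t → (1 - t) • g y + t • p ∈ arrangementCompl V} := by
  let φ (j : ι) (z : V j × F × ℝ) : E := (z.1 : E) - z.2.2 • g z.2.1
  have hφ (j : ι) : ContDiff ℝ 1 (φ j) := by
    have h : ContDiff ℝ 1 (fun z : V j × F × ℝ ↦ (z.1 : E)) :=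
      (V j).subtypeL.contDiff.comp contDiff_fst
    fun_prop
  rcases isEmpty_or_nonempty ι with h | h
  · simp [arrangementCompl]
  have hdim : dimH (⋃ j, range (φ j)) < finrank ℝ E := by
    rw [dimH_iUnion]
    obtain ⟨j, hj⟩ := exists_eq_ciSup_of_finite (f := fun j ↦ dimH (range (φ j)))
    rw [← hj]
    refine (hφ j).dimH_range_le.trans_lt (Nat.cast_lt.2 ?_)
    simpa [add_assoc] using hV j
  refine (dense_compl_of_dimH_lt_finrank hdim).mono ?_
  intro p hp y t ht j hj
  refine hp ?_
  refine mem_iUnion.2 ⟨j, ⟨t⁻¹ • ⟨_, hj⟩, y, t⁻¹ * (1 - t)⟩, ?_⟩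
  simp [φ, smul_smul, ht.ne']

theorem isOpen_arrangementCompl : IsOpen (arrangementCompl V) := by
  have : arrangementCompl V = ⋂ j, (V j : Set E)ᶜ := by ext; simp [arrangementCompl]
  rw [this]
  exact isOpen_iInter_of_finite fun j ↦ (V j).closed_of_finiteDimensional.isOpen_compl

theorem isPathConnected_arrangementCompl (hV : ∀ j, finrank ℝ (V j) + 2 < finrank ℝ E) :
    IsPathConnected (arrangementCompl V) := by
  have key (x y : E) : ∃ p, ∀ s t : ℝ, 0 < t →
      (1 - t) • (x + s • (y - x)) + t • p ∈ arrangementCompl V :=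
    (dense_forall_segment_mem_arrangementCompl (F := ℝ) (by simpa using hV)
      (g := fun s ↦ x + s • (y - x)) (by fun_prop)).nonempty
  refine isPathConnected_iff.2 ⟨?_, fun x hx y hy ↦ ?_⟩
  · obtain ⟨p, hp⟩ := key 0 0
    exact ⟨p, by simpa using hp 0 1 one_pos⟩
  · obtain ⟨p, hp⟩ := key x y
    have aux (s : ℝ) (hs : x + s • (y - x) ∈ arrangementCompl V) :
        JoinedIn (arrangementCompl V) (x + s • (y - x)) p := by
      refine JoinedIn.of_segment_subset ?_
      rintro _ ⟨a, b, -, hb, hab, rfl⟩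
      obtain rfl : a = 1 - b := by linarith
      rcases hb.eq_or_lt with rfl | hb
      · simpa using hs
      · exact hp s b hb
    have h0 := aux 0 (by simpa using hx)
    have h1 := aux 1 (by simpa using hy)
    simp only [zero_smul, add_zero, one_smul, add_sub_cancel] at h0 h1
    exact h0.trans h1.symm

/-- If all the subspaces `V j` have codimension at least `|N| + 2`, then the homotopy group
indexed by `N` of their complement is trivial. -/
theorem subsingleton_homotopyGroup_arrangementCompl {N : Type*} [Fintype N]
    (hV : ∀ j, finrank ℝ (V j) + Fintype.card N + 1 < finrank ℝ E) (x : arrangementCompl V) :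
    Subsingleton (HomotopyGroup N (arrangementCompl V) x) := by
  suffices h : ∀ f : GenLoop N (arrangementCompl V) x, GenLoop.Homotopic f GenLoop.const by
    refine ⟨fun a b ↦ ?_⟩
    induction a using Quotient.inductionOn with | _ a
    induction b using Quotient.inductionOn with | _ b
    exact Quotient.sound ((h a).trans (h b).symm)
  intro f
  obtain ⟨δ, hδ, hδU⟩ : ∃ δ > 0,
      Metric.thickening δ (insert (x : E) (range fun s ↦ (f s : E))) ⊆ arrangementCompl V := by
    refine IsCompact.exists_thickening_subset_open ?_ isOpen_arrangementCompl ?_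
    · exact (isCompact_range (by fun_prop)).insert _
    · rintro _ (rfl | ⟨s, rfl⟩)
      exacts [x.2, (f s).2]
  have hballx : Metric.ball (x : E) δ ⊆ arrangementCompl V := fun y hy ↦
    hδU (Metric.mem_thickening_iff.2 ⟨x, mem_insert _ _, hy⟩)
  have hballf (s) : Metric.ball (f s : E) δ ⊆ arrangementCompl V := fun y hy ↦
    hδU (Metric.mem_thickening_iff.2 ⟨f s, mem_insert_of_mem _ ⟨s, rfl⟩, hy⟩)
  -- a map collapsing a neighbourhood of the base point
  let c (y : E) : ℝ := max 0 (min 1 (4 / δ * dist y x - 1))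
  let ρ (y : E) : E := AffineMap.lineMap (x : E) y (c y)
  have hc0 (y : E) : 0 ≤ c y := le_max_left _ _
  have hc1 (y : E) : c y ≤ 1 := max_le zero_le_one (min_le_left _ _)
  have hcρ (y : E) (hy : y ∈ Metric.ball (x : E) (δ / 4)) : ρ y = x := by
    have : 4 / δ * dist y x ≤ 1 := by
      rw [Metric.mem_ball] at hy
      rw [div_mul_eq_mul_div, div_le_one hδ]
      linarith
    have : c y = 0 := max_eq_left ((min_le_right _ _).trans (by linarith))
    simp [ρ, this]
  have hρseg (y : E) : ρ y ∈ segment ℝ (x : E) y := by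
    rw [segment_eq_image_lineMap]
    exact ⟨c y, ⟨hc0 y, hc1 y⟩, rfl⟩
  have hρU (y : E) (hy : y ∈ arrangementCompl V) : segment ℝ y (ρ y) ⊆ arrangementCompl V := by
    by_cases h : y ∈ Metric.ball (x : E) δ
    · have hx : (x : E) ∈ Metric.ball (x : E) δ := Metric.mem_ball_self hδ
      have hconv := convex_ball (x : E) δ
      exact (hconv.segment_subset h (hconv.segment_subset hx h (hρseg y))).trans hballx
    · have h4 : 4 ≤ 4 / δ * dist y x := by
        rw [Metric.mem_ball, not_lt] at h
        rw [div_mul_eq_mul_div, le_div_iff₀ hδ]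
        linarith
      have : c y = 1 := by
        simp only [c]
        rw [min_eq_left (by linarith), max_eq_right zero_le_one]
      simpa [ρ, this] using hy
  let r : C(arrangementCompl V, arrangementCompl V) :=
    ⟨fun y ↦ ⟨ρ y, hρU y y.2 (right_mem_segment ℝ _ _)⟩, by
    simp only [ρ, c, AffineMap.lineMap_apply_module]
    fun_prop⟩
  have hr (y : arrangementCompl V) (hy : (y : E) ∈ Metric.ball (x : E) (δ / 4)) : r y = x :=
    Subtype.ext (hcρ y hy)
  -- smooth approximation
  obtain ⟨g, hg, hgf⟩ : ∃ g : (N → ℝ) → E, ContDiff ℝ 1 g ∧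
      ∀ s : N → I, dist (g fun i ↦ s i) (f s) < δ / 4 := by
    have hf : Continuous fun v : N → ℝ ↦ (f (fun i ↦ projIcc 0 1 zero_le_one (v i)) : E) := by
      fun_prop
    obtain ⟨g, hg, hgf, -⟩ := hf.exists_contDiff_approx 1 (ε := fun _ ↦ δ / 4) continuous_const
      (fun _ ↦ by positivity)
    exact ⟨g, hg, fun s ↦ by simpa using hgf fun i ↦ s i⟩
  have hfg (s : N → I) : segment ℝ (f s : E) (g fun i ↦ s i) ⊆ Metric.ball (f s : E) (δ / 4) :=
    (convex_ball _ _).segment_subset (Metric.mem_ball_self (by positivity)) (hgf s)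
  have hsub (y : E) : Metric.ball y (δ / 4) ⊆ Metric.ball y δ :=
    Metric.ball_subset_ball (by linarith)
  have hgU (s : N → I) : (g fun i ↦ s i) ∈ arrangementCompl V := hballf s (hsub _ (hgf s))
  obtain ⟨p, hp, hpx⟩ := (dense_forall_segment_mem_arrangementCompl (V := V)
    (by simpa using hV) hg).exists_mem_open Metric.isOpen_ball
    ⟨(x : E), Metric.mem_ball_self (show 0 < δ / 4 by positivity)⟩
  have hpU : p ∈ arrangementCompl V := hballx (hsub _ hpx)
  let G : C(N → I, arrangementCompl V) := ⟨fun s ↦ ⟨g fun i ↦ s i, hgU s⟩, by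
    have := hg.continuous
    fun_prop⟩
  have h1 : f.1.HomotopicRel (r.comp f.1) (Cube.boundary N) := by
    refine ContinuousMap.homotopicRel_comp_of_segment (.id (arrangementCompl V)) f.1 (r.comp f.1) _
      (fun s ↦ hρU _ (f s).2) fun s hs y hy ↦ ?_
    have hfx : f.1 s = x := f.2 s hs
    have hrx : r x = x := hr x (Metric.mem_ball_self (by positivity))
    simp only [ContinuousMap.comp_apply, hfx, hrx, segment_same, mem_singleton_iff] at hy
    simpa [hfx] using Subtype.ext hy
  have h2 : (r.comp f.1).HomotopicRel (r.comp G) (Cube.boundary N) := by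
    refine ContinuousMap.homotopicRel_comp_of_segment r f.1 G _
      (fun s ↦ (hfg s).trans ((hsub _).trans (hballf s))) fun s hs y hy ↦ ?_
    have hfx : f s = x := f.2 s hs
    have hy' := hfg s hy
    rw [hfx] at hy'
    rw [hr y hy', GenLoop.coe_coe, hfx, hr x (Metric.mem_ball_self (by positivity))]
  have h3 : (r.comp G).HomotopicRel (r.comp (.const _ ⟨p, hpU⟩)) (Cube.boundary N) := by
    refine ContinuousMap.homotopicRel_comp_of_segment r G _ _ (fun s ↦ ?_) fun s hs y hy ↦ ?_
    · rintro _ ⟨a, b, -, hb, hab, rfl⟩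
      obtain rfl : a = 1 - b := by linarith
      rcases hb.eq_or_lt with rfl | hb
      · simp
      · exact hp _ b hb
    · have hfx : f s = x := f.2 s hs
      have hgx := hgf s
      rw [hfx] at hgx
      rw [hr y ((convex_ball _ _).segment_subset hgx hpx hy), hr (G s) hgx]
  have h4 : r.comp (.const _ ⟨p, hpU⟩) = (GenLoop.const : GenLoop N (arrangementCompl V) x).1 := by
    ext1 s
    exact hr _ hpx
  rw [h4] at h3
  exact (h1.trans h2).trans h3

end Arrangement

/-- The diagonal subspace `A_I` of `(ℝ^d)^n`, where all points indexed by `I` coincide. -/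
def diagonalSubspace (d : ℕ) {n : ℕ} (I : Finset (Fin n)) : Submodule ℝ (Fin n → Fin d → ℝ) where
  carrier := {x | ∀ i ∈ I, ∀ j ∈ I, x i = x j}
  add_mem' := fun hx hy i hi j hj ↦ by simp [hx i hi j hj, hy i hi j hj]
  zero_mem' := by simp
  smul_mem' := fun a x hx i hi j hj ↦ by simp [hx i hi j hj]

theorem finrank_diagonalSubspace (d : ℕ) {n : ℕ} {I : Finset (Fin n)} (hI : I.Nonempty) :
    Module.finrank ℝ (diagonalSubspace d I) + d * (I.card - 1) = n * d := by
  obtain ⟨i₀, hi₀⟩ := hI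
  let φ : (Fin n → Fin d → ℝ) →ₗ[ℝ] (I.erase i₀ → Fin d → ℝ) :=
    let π : (i : Fin n) → (Fin n → Fin d → ℝ) →ₗ[ℝ] Fin d → ℝ := LinearMap.proj
    LinearMap.pi fun i ↦ π i - π i₀
  have hker : LinearMap.ker φ = diagonalSubspace d I := by
    ext x
    simp only [LinearMap.mem_ker, funext_iff (f := φ x)]
    constructor
    · intro h
      have h' (i) (hi : i ∈ I) : x i = x i₀ := by
        by_cases hii : i = i₀
        · rw [hii]
        · exact sub_eq_zero.1 (h ⟨i, Finset.mem_erase.2 ⟨hii, hi⟩⟩)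
      exact fun i hi j hj ↦ (h' i hi).trans (h' j hj).symm
    · exact fun h i ↦ sub_eq_zero.2 (h i (Finset.mem_of_mem_erase i.2) i₀ hi₀)
  have hsurj : Function.Surjective φ := by
    intro y
    refine ⟨fun i ↦ if h : i ∈ I.erase i₀ then y ⟨i, h⟩ else 0, ?_⟩
    ext1 i
    simp [φ, (Finset.mem_erase.1 i.2).1, (Finset.mem_erase.1 i.2).2]
  have h := φ.finrank_range_add_finrank_ker
  rw [hker, LinearMap.range_eq_top.2 hsurj, finrank_top] at h
  simp only [Module.finrank_pi_fintype, Module.finrank_self, Finset.sum_const, Finset.card_univ,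
    Fintype.card_fin, smul_eq_mul, mul_one, Fintype.card_coe, Finset.card_erase_of_mem hi₀] at h
  rw [mul_comm d, add_comm]
  exact h

theorem nonKEqual_eq_arrangementCompl (d k n : ℕ) :
    nonKEqual d k n =
      arrangementCompl fun I : {I : Finset (Fin n) // I.card = k} ↦ diagonalSubspace d I.1 := by
  ext x
  simp [nonKEqual, arrangementCompl, diagonalSubspace]

/-- For `d ≥ 2`, `k ≥ 3`, `n ≥ 1`, the non-`k`-equal manifold is
`(d(k−1)−2)`-connected: nonempty, path-connected, with trivial homotopy groups `π_i` for
`1 ≤ i ≤ d(k−1)−2`; in particular it is simply connected. -/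
theorem nonKEqual_highly_connected (d k n : ℕ) (hd : 2 ≤ d) (hk : 3 ≤ k) (hn : 1 ≤ n) :
    (nonKEqual d k n).Nonempty ∧
    IsPathConnected (nonKEqual d k n) ∧
    (∀ (x : Fin n → Fin d → ℝ) (hx : x ∈ nonKEqual d k n),
      ∀ i : ℕ, 1 ≤ i → i ≤ d * (k - 1) - 2 →
        Subsingleton (HomotopyGroup (Fin i) ↥(nonKEqual d k n) ⟨x, hx⟩)) ∧
    SimplyConnectedSpace ↥(nonKEqual d k n) := by
  have hcodim (i : ℕ) (hi : i ≤ d * (k - 1) - 2) (I : {I : Finset (Fin n) // I.card = k}) :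
      Module.finrank ℝ (diagonalSubspace d I.1) + i + 1 <
        Module.finrank ℝ (Fin n → Fin d → ℝ) := by
    have h := finrank_diagonalSubspace d (Finset.card_pos.1 (by rw [I.2]; omega : 0 < I.1.card))
    have h4 : 2 * 2 ≤ d * (k - 1) := Nat.mul_le_mul hd (by omega)
    rw [I.2] at h
    simp only [Module.finrank_pi_fintype, Module.finrank_self, Finset.sum_const, Finset.card_univ,
      Fintype.card_fin, smul_eq_mul, mul_one]
    omega
  have hone : 1 ≤ d * (k - 1) - 2 := by
    have h4 : 2 * 2 ≤ d * (k - 1) := Nat.mul_le_mul hd (by omega)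
    omega
  rw [nonKEqual_eq_arrangementCompl]
  have hpath := isPathConnected_arrangementCompl (hcodim 1 hone)
  have hpi (i : ℕ) (hi : i ≤ d * (k - 1) - 2) :=
    subsingleton_homotopyGroup_arrangementCompl (N := Fin i)
      (V := fun I : {I : Finset (Fin n) // I.card = k} ↦ diagonalSubspace d I.1)
      (by rw [Fintype.card_fin]; exact hcodim i hi)
  refine ⟨hpath.nonempty, hpath, fun x hx i _ hi ↦ hpi i hi ⟨x, hx⟩, ?_⟩
  refine simply_connected_iff_loops_nullhomotopic.2
    ⟨isPathConnected_iff_pathConnectedSpace.1 hpath, fun x γ ↦ ?_⟩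
  have h1 : Subsingleton (HomotopyGroup.Pi 1 _ x) := hpi 1 hone x
  have h2 := (HomotopyGroup.pi1EquivFundamentalGroup (x := x)).symm.subsingleton
  exact Quotient.exact (Subsingleton.elim (FundamentalGroup.fromPath ⟦γ⟧)
    (FundamentalGroup.fromPath ⟦Path.refl x⟧))
end

section
/- Let d ≥ 2 and n ≥ 5, and in (ℝ^d)^n set c_K = {x : x_1 = x_2, p_1(x_1) = p_1(x_3), x_1^(1) ≤ x_3^(1)}, c_L = {x : x_3 = x_4, p_1(x_3) = p_1(x_5), x_3^(1) ≤ x_5^(1)}, and c_X = {x : x_3 = x_4, p_1(x_i) = p_1(x_j) for all i, j ∈ {1,2,3,4,5}, x_1^(1) ≤ x_2^(1), x_1^(1) ≤ x_3^(1), x_3^(1) ≤ x_5^(1)}. Then c_K ∩ c_L ∩ M_d^(3)(n) = {x ∈ c_X : x_1^(1) = x_2^(1) or x_1^(1) = x_3^(1) or x_3^(1) = x_5^(1)} ∩ M_d^(3)(n). -/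
/-- The linear cell `c_K = {x : x_1 = x_2, p_1(x_1) = p_1(x_3), x_1^(1) ≤ x_3^(1)}`
(indices shifted to `0,…,n−1`). -/
def cellK (d n : ℕ) [NeZero d] [NeZero n] : Set (Fin n → Fin d → ℝ) :=
  {x | x 0 = x 1 ∧ (∀ a : Fin d, a ≠ 0 → x 0 a = x 2 a) ∧ x 0 0 ≤ x 2 0}

/-- The linear cell `c_L = {x : x_3 = x_4, p_1(x_3) = p_1(x_5), x_3^(1) ≤ x_5^(1)}`. -/
def cellL (d n : ℕ) [NeZero d] [NeZero n] : Set (Fin n → Fin d → ℝ) :=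
  {x | x 2 = x 3 ∧ (∀ a : Fin d, a ≠ 0 → x 2 a = x 4 a) ∧ x 2 0 ≤ x 4 0}

/-- The linear cell `c_X = {x : x_3 = x_4, p_1(x_i) = p_1(x_j) for all i,j ∈ {1,…,5},
x_1^(1) ≤ x_2^(1), x_1^(1) ≤ x_3^(1), x_3^(1) ≤ x_5^(1)}`. -/
def cellX (d n : ℕ) [NeZero d] [NeZero n] : Set (Fin n → Fin d → ℝ) :=
  {x | x 2 = x 3 ∧
    (∀ i j : Fin n, i.val < 5 → j.val < 5 → ∀ a : Fin d, a ≠ 0 → x i a = x j a) ∧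
    x 0 0 ≤ x 1 0 ∧ x 0 0 ≤ x 2 0 ∧ x 2 0 ≤ x 4 0}

theorem nonKEqual.not_all_eq {d n : ℕ} {x : Fin n → Fin d → ℝ} (hx : x ∈ nonKEqual d 3 n)
    {i j k : Fin n} (hij : i ≠ j) (hik : i ≠ k) (hjk : j ≠ k) : ¬(x i = x j ∧ x j = x k) := by
  rintro ⟨h₁, h₂⟩
  obtain ⟨a, ha, b, hb, hab⟩ := hx {i, j, k} (Finset.card_eq_three.2 ⟨i, j, k, hij, hik, hjk, rfl⟩)
  simp only [Finset.mem_insert, Finset.mem_singleton] at ha hb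
  rcases ha with rfl | rfl | rfl <;> rcases hb with rfl | rfl | rfl <;> simp_all

theorem Fin.val_literals_of_five_le {n : ℕ} [NeZero n] (hn : 5 ≤ n) :
    ((0 : Fin n) : ℕ) = 0 ∧ ((1 : Fin n) : ℕ) = 1 ∧ ((2 : Fin n) : ℕ) = 2 ∧
      ((3 : Fin n) : ℕ) = 3 ∧ ((4 : Fin n) : ℕ) = 4 :=
  ⟨Nat.mod_eq_of_lt (show 0 < n by omega), Nat.mod_eq_of_lt (show 1 < n by omega),
    Nat.mod_eq_of_lt (show 2 < n by omega), Nat.mod_eq_of_lt (show 3 < n by omega),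
    Nat.mod_eq_of_lt (show 4 < n by omega)⟩

theorem Fin.eq_of_val_lt_five {n : ℕ} [NeZero n] (hn : 5 ≤ n) {i : Fin n} (hi : i.val < 5) :
    i = 0 ∨ i = 1 ∨ i = 2 ∨ i = 3 ∨ i = 4 := by
  obtain ⟨h0, h1, h2, h3, h4⟩ := Fin.val_literals_of_five_le hn
  simp only [Fin.ext_iff] at *
  omega

/-- inside `M_d^(3)(n)`, the transverse intersection `c_K ∩ c_L` is exactly the
boundary of the cell `c_X`. -/
theorem cellK_inter_cellL_eq_boundary_cellX (d n : ℕ) [NeZero d] [NeZero n]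
    (hd : 2 ≤ d) (hn : 5 ≤ n) :
    cellK d n ∩ cellL d n ∩ nonKEqual d 3 n =
      {x ∈ cellX d n | x 0 0 = x 1 0 ∨ x 0 0 = x 2 0 ∨ x 2 0 = x 4 0} ∩ nonKEqual d 3 n := by
  obtain ⟨h0, h1, h2, h3, h4⟩ := Fin.val_literals_of_five_le hn
  ext x
  constructor
  · rintro ⟨⟨⟨h01, h02, hle⟩, h23, h24, hle'⟩, hx⟩
    refine ⟨⟨⟨h23, ?_, (congrFun h01 0).le, hle, hle'⟩, Or.inl (congrFun h01 0)⟩, hx⟩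
    have key : ∀ i : Fin n, i.val < 5 → ∀ a : Fin d, a ≠ 0 → x i a = x 2 a := by
      intro i hi a ha
      rcases Fin.eq_of_val_lt_five hn hi with rfl | rfl | rfl | rfl | rfl
      · exact h02 a ha
      · rw [← h01]; exact h02 a ha
      · rfl
      · rw [h23]
      · exact (h24 a ha).symm
    intro i j hi hj a ha
    rw [key i hi a ha, key j hj a ha]
  · rintro ⟨⟨⟨h23, hp, -, hle, hle'⟩, hor⟩, hx⟩
    have eq_of : ∀ i j : Fin n, i.val < 5 → j.val < 5 → x i 0 = x j 0 → x i = x j := by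
      intro i j hi hj h
      funext a
      by_cases ha : a = 0
      · rw [ha, h]
      · exact hp i j hi hj a ha
    refine ⟨⟨⟨?_, hp 0 2 (by omega) (by omega), hle⟩, h23, hp 2 4 (by omega) (by omega), hle'⟩, hx⟩
    rcases hor with h | h | h
    · exact eq_of 0 1 (by omega) (by omega) h
    · refine (nonKEqual.not_all_eq hx (i := 0) (j := 2) (k := 3) ?_ ?_ ?_
        ⟨eq_of 0 2 (by omega) (by omega) h, h23⟩).elim <;> rw [Ne, Fin.ext_iff] <;> omega
    · refine (nonKEqual.not_all_eq hx (i := 3) (j := 2) (k := 4) ?_ ?_ ?_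
        ⟨h23.symm, eq_of 2 4 (by omega) (by omega) h⟩).elim <;> rw [Ne, Fin.ext_iff] <;> omega
end

section
/- Let d ≥ 2 and n ≥ 7, and in (ℝ^d)^n set c_L = {x : x_3 = x_4, p_1(x_3) = p_1(x_5), x_3^(1) ≤ x_5^(1)}, c_M = {x : x_5 = x_6, p_1(x_5) = p_1(x_7), x_5^(1) ≤ x_7^(1)}, and c_Y = {x : x_5 = x_6, p_1(x_i) = p_1(x_j) for all i, j ∈ {3,4,5,6,7}, x_3^(1) ≤ x_4^(1), x_3^(1) ≤ x_5^(1), x_5^(1) ≤ x_7^(1)}. Then c_L ∩ c_M ∩ M_d^(3)(n) = {x ∈ c_Y : x_3^(1) = x_4^(1) or x_3^(1) = x_5^(1) or x_5^(1) = x_7^(1)} ∩ M_d^(3)(n). -/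
/-- The linear cell `c_M = {x : x_5 = x_6, p_1(x_5) = p_1(x_7), x_5^(1) ≤ x_7^(1)}`. -/
def cellM (d n : ℕ) [NeZero d] [NeZero n] : Set (Fin n → Fin d → ℝ) :=
  {x | x 4 = x 5 ∧ (∀ a : Fin d, a ≠ 0 → x 4 a = x 6 a) ∧ x 4 0 ≤ x 6 0}

/-- The linear cell `c_Y = {x : x_5 = x_6, p_1(x_i) = p_1(x_j) for all i,j ∈ {3,…,7},
x_3^(1) ≤ x_4^(1), x_3^(1) ≤ x_5^(1), x_5^(1) ≤ x_7^(1)}`. -/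
def cellY (d n : ℕ) [NeZero d] [NeZero n] : Set (Fin n → Fin d → ℝ) :=
  {x | x 4 = x 5 ∧
    (∀ i j : Fin n, 2 ≤ i.val → i.val < 7 → 2 ≤ j.val → j.val < 7 →
      ∀ a : Fin d, a ≠ 0 → x i a = x j a) ∧
    x 2 0 ≤ x 3 0 ∧ x 2 0 ≤ x 4 0 ∧ x 4 0 ≤ x 6 0}

/-- The points of the non-`3`-equal manifold have no three equal coordinates. -/
lemma not_mem_nonKEqual_three {d n : ℕ} {x : Fin n → Fin d → ℝ} {i j k : Fin n}
    (hij : i ≠ j) (hik : i ≠ k) (hjk : j ≠ k) (h₁ : x i = x j) (h₂ : x j = x k) :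
    x ∉ nonKEqual d 3 n := by
  intro hx
  obtain ⟨a, ha, b, hb, hab⟩ := hx {i, j, k} (Finset.card_eq_three.2 ⟨i, j, k, hij, hik, hjk, rfl⟩)
  have key : ∀ c ∈ ({i, j, k} : Finset (Fin n)), x c = x k := by
    simp [h₁, h₂]
  exact hab ((key a ha).trans (key b hb).symm)

/-- Two vectors agreeing in the first coordinate and in all the others are equal. -/
lemma eq_of_zero_of_ne_zero {d : ℕ} [NeZero d] {u v : Fin d → ℝ} (h₀ : u 0 = v 0)
    (h : ∀ a : Fin d, a ≠ 0 → u a = v a) : u = v := by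
  funext a
  by_cases ha : a = 0
  · rw [ha, h₀]
  · exact h a ha

/-- inside `M_d^(3)(n)`, the transverse intersection `c_L ∩ c_M` is exactly the
boundary of the cell `c_Y`. -/
theorem cellL_inter_cellM_eq_boundary_cellY (d n : ℕ) [NeZero d] [NeZero n]
    (hd : 2 ≤ d) (hn : 7 ≤ n) :
    cellL d n ∩ cellM d n ∩ nonKEqual d 3 n =
      {x ∈ cellY d n | x 2 0 = x 3 0 ∨ x 2 0 = x 4 0 ∨ x 4 0 = x 6 0} ∩ nonKEqual d 3 n := by
  have v2 : (2 : Fin n).val = 2 := Nat.mod_eq_of_lt (show 2 < n by omega)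
  have v3 : (3 : Fin n).val = 3 := Nat.mod_eq_of_lt (show 3 < n by omega)
  have v4 : (4 : Fin n).val = 4 := Nat.mod_eq_of_lt (show 4 < n by omega)
  have v5 : (5 : Fin n).val = 5 := Nat.mod_eq_of_lt (show 5 < n by omega)
  have v6 : (6 : Fin n).val = 6 := Nat.mod_eq_of_lt (show 6 < n by omega)
  ext x
  constructor
  · rintro ⟨⟨⟨h23, h24, hle⟩, h45, h46, hle'⟩, hx⟩
    have key : ∀ i : Fin n, 2 ≤ i.val → i.val < 7 → ∀ a : Fin d, a ≠ 0 → x i a = x 4 a := by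
      intro i hi hi' a ha
      have hcases : i = 2 ∨ i = 3 ∨ i = 4 ∨ i = 5 ∨ i = 6 := by
        simp only [Fin.ext_iff]
        omega
      rcases hcases with rfl | rfl | rfl | rfl | rfl
      · exact h24 a ha
      · rw [← h23]
        exact h24 a ha
      · rfl
      · rw [h45]
      · exact (h46 a ha).symm
    have h0 : x 2 0 = x 3 0 := congrFun h23 0
    exact ⟨⟨⟨h45, fun i j hi hi' hj hj' a ha => (key i hi hi' a ha).trans (key j hj hj' a ha).symm,
      h0.le, hle, hle'⟩, Or.inl h0⟩, hx⟩
  · rintro ⟨⟨⟨h45, hp, -, hle, hle'⟩, h⟩, hx⟩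
    have h24 := hp 2 4 (by omega) (by omega) (by omega) (by omega)
    have h46 := hp 4 6 (by omega) (by omega) (by omega) (by omega)
    have h23 := hp 2 3 (by omega) (by omega) (by omega) (by omega)
    rcases h with h | h | h
    · exact ⟨⟨⟨eq_of_zero_of_ne_zero h h23, h24, hle⟩, h45, h46, hle'⟩, hx⟩
    · exact absurd hx (not_mem_nonKEqual_three (i := 2) (j := 4) (k := 5)
        (Fin.ne_of_val_ne (by omega)) (Fin.ne_of_val_ne (by omega)) (Fin.ne_of_val_ne (by omega))
        (eq_of_zero_of_ne_zero h h24) h45)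
    · exact absurd hx (not_mem_nonKEqual_three (i := 5) (j := 4) (k := 6)
        (Fin.ne_of_val_ne (by omega)) (Fin.ne_of_val_ne (by omega)) (Fin.ne_of_val_ne (by omega))
        h45.symm (eq_of_zero_of_ne_zero h h46))
end

section
/- Let d ≥ 1 and n ≥ 7. In (ℝ^d)^n consider the linear subspaces V_X = {x : x_3 = x_4 and p_1(x_i) = p_1(x_j) for all i, j ∈ {1,2,3,4,5}}, V_M = {x : x_5 = x_6, p_1(x_5) = p_1(x_7)}, V_K = {x : x_1 = x_2, p_1(x_1) = p_1(x_3)}, and V_Y = {x : x_5 = x_6 and p_1(x_i) = p_1(x_j) for all i, j ∈ {3,4,5,6,7}}. Then V_X + V_M = (ℝ^d)^n and V_K + V_Y = (ℝ^d)^n. -/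
/-- The linear subspace `V_X = {x : x_3 = x_4 and p_1(x_i) = p_1(x_j) for all i,j ∈ {1,…,5}}`
of `(ℝ^d)^n` (indices shifted to `0,…,n−1`). -/
def spanVX (d n : ℕ) [NeZero d] [NeZero n] : Submodule ℝ (Fin n → Fin d → ℝ) where
  carrier := {x | x 2 = x 3 ∧
    ∀ i j : Fin n, i.val < 5 → j.val < 5 → ∀ a : Fin d, a ≠ 0 → x i a = x j a}
  add_mem' := by
    rintro x y ⟨hx1, hx2⟩ ⟨hy1, hy2⟩
    exact ⟨by simp [Pi.add_apply, hx1, hy1], fun i j hi hj a ha => by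
      simp [Pi.add_apply, hx2 i j hi hj a ha, hy2 i j hi hj a ha]⟩
  zero_mem' := ⟨rfl, fun _ _ _ _ _ _ => rfl⟩
  smul_mem' := by
    rintro c x ⟨hx1, hx2⟩
    exact ⟨by simp [Pi.smul_apply, hx1], fun i j hi hj a ha => by
      simp [Pi.smul_apply, hx2 i j hi hj a ha]⟩

/-- The linear subspace `V_M = {x : x_5 = x_6, p_1(x_5) = p_1(x_7)}` of `(ℝ^d)^n`. -/
def spanVM (d n : ℕ) [NeZero d] [NeZero n] : Submodule ℝ (Fin n → Fin d → ℝ) where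
  carrier := {x | x 4 = x 5 ∧ ∀ a : Fin d, a ≠ 0 → x 4 a = x 6 a}
  add_mem' := by
    rintro x y ⟨hx1, hx2⟩ ⟨hy1, hy2⟩
    exact ⟨by simp [Pi.add_apply, hx1, hy1], fun a ha => by
      simp [Pi.add_apply, hx2 a ha, hy2 a ha]⟩
  zero_mem' := ⟨rfl, fun _ _ => rfl⟩
  smul_mem' := by
    rintro c x ⟨hx1, hx2⟩
    exact ⟨by simp [Pi.smul_apply, hx1], fun a ha => by simp [Pi.smul_apply, hx2 a ha]⟩

/-- The linear subspace `V_K = {x : x_1 = x_2, p_1(x_1) = p_1(x_3)}` of `(ℝ^d)^n`. -/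
def spanVK (d n : ℕ) [NeZero d] [NeZero n] : Submodule ℝ (Fin n → Fin d → ℝ) where
  carrier := {x | x 0 = x 1 ∧ ∀ a : Fin d, a ≠ 0 → x 0 a = x 2 a}
  add_mem' := by
    rintro x y ⟨hx1, hx2⟩ ⟨hy1, hy2⟩
    exact ⟨by simp [Pi.add_apply, hx1, hy1], fun a ha => by
      simp [Pi.add_apply, hx2 a ha, hy2 a ha]⟩
  zero_mem' := ⟨rfl, fun _ _ => rfl⟩
  smul_mem' := by
    rintro c x ⟨hx1, hx2⟩
    exact ⟨by simp [Pi.smul_apply, hx1], fun a ha => by simp [Pi.smul_apply, hx2 a ha]⟩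

/-- The linear subspace `V_Y = {x : x_5 = x_6 and p_1(x_i) = p_1(x_j) for all i,j ∈ {3,…,7}}`
of `(ℝ^d)^n`. -/
def spanVY (d n : ℕ) [NeZero d] [NeZero n] : Submodule ℝ (Fin n → Fin d → ℝ) where
  carrier := {x | x 4 = x 5 ∧
    ∀ i j : Fin n, 2 ≤ i.val → i.val < 7 → 2 ≤ j.val → j.val < 7 →
      ∀ a : Fin d, a ≠ 0 → x i a = x j a}
  add_mem' := by
    rintro x y ⟨hx1, hx2⟩ ⟨hy1, hy2⟩
    exact ⟨by simp [Pi.add_apply, hx1, hy1], fun i j hi hi' hj hj' a ha => by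
      simp [Pi.add_apply, hx2 i j hi hi' hj hj' a ha, hy2 i j hi hi' hj hj' a ha]⟩
  zero_mem' := ⟨rfl, fun _ _ _ _ _ _ _ _ => rfl⟩
  smul_mem' := by
    rintro c x ⟨hx1, hx2⟩
    exact ⟨by simp [Pi.smul_apply, hx1], fun i j hi hi' hj hj' a ha => by
      simp [Pi.smul_apply, hx2 i j hi hi' hj hj' a ha]⟩

/-- `V_X + V_M = (ℝ^d)^n` and `V_K + V_Y = (ℝ^d)^n`: the transversality of the
intersections `X ∩ M` and `K ∩ Y` used in the geometric evaluation of the triple Massey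
product in `M_d^(3)(n)`. -/
theorem spanVX_sup_spanVM_and_spanVK_sup_spanVY (d n : ℕ) [NeZero d] [NeZero n]
    (hd : 1 ≤ d) (hn : 7 ≤ n) :
    spanVX d n ⊔ spanVM d n = ⊤ ∧ spanVK d n ⊔ spanVY d n = ⊤ := by
  have h1 : 1 % n = 1 := Nat.mod_eq_of_lt (by lia)
  have h2 : 2 % n = 2 := Nat.mod_eq_of_lt (by lia)
  have h3 : 3 % n = 3 := Nat.mod_eq_of_lt (by lia)
  have h4 : 4 % n = 4 := Nat.mod_eq_of_lt (by lia)
  have h5 : 5 % n = 5 := Nat.mod_eq_of_lt (by lia)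
  have h6 : 6 % n = 6 := Nat.mod_eq_of_lt (by lia)
  constructor
  · refine eq_top_iff.2 fun z _ => ?_
    let x : Fin n → Fin d → ℝ := fun i => if i.val < 5 then 0 else z i - z 4
    refine Submodule.mem_sup.2 ⟨x, ⟨?_, fun i j hi hj a _ => ?_⟩, z - x, ⟨?_, fun a _ => ?_⟩,
      add_sub_cancel x z⟩
    · simp [x, h2, h3]
    · simp [x, hi, hj]
    · simp [x, h5]
    · simp [x, h6]
  · refine eq_top_iff.2 fun z _ => ?_
    let y : Fin n → Fin d → ℝ := fun i => if 2 ≤ i.val then 0 else z i - z 2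
    refine Submodule.mem_sup.2 ⟨z - y, ⟨?_, fun a _ => ?_⟩, y, ⟨?_, fun i j hi _ hj _ a _ => ?_⟩,
      sub_add_cancel z y⟩
    · simp [y, h1]
    · simp [y]
    · simp [y, h4, h5]
    · simp [y, hi, hj]
end

section
/- Let d ≥ 2 and n ≥ 7. In (ℝ^d)^n define c_K = {x : x_1 = x_2, p_1(x_1) = p_1(x_3), x_1^(1) ≤ x_3^(1)}, c_M = {x : x_5 = x_6, p_1(x_5) = p_1(x_7), x_5^(1) ≤ x_7^(1)}, c_X = {x : x_3 = x_4, p_1(x_i) = p_1(x_j) for all i, j ∈ {1,…,5}, x_1^(1) ≤ x_2^(1), x_1^(1) ≤ x_3^(1), x_3^(1) ≤ x_5^(1)}, c_Y = {x : x_5 = x_6, p_1(x_i) = p_1(x_j) for all i, j ∈ {3,…,7}, x_3^(1) ≤ x_4^(1), x_3^(1) ≤ x_5^(1), x_5^(1) ≤ x_7^(1)}, c_Z = {x : x_5 = x_6, p_1(x_i) = p_1(x_j) for all i, j ∈ {1,…,7}, x_1^(1) ≤ x_2^(1), x_1^(1) ≤ x_3^(1), x_3^(1) ≤ x_4^(1),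 x_3^(1) ≤ x_5^(1), x_5^(1) ≤ x_7^(1)}, and c_P = {x : x_1 = x_3, x_5 = x_6, p_1(x_i) = p_1(x_j) for all i, j ∈ {1,…,7}, x_1^(1) ≤ x_2^(1), x_1^(1) ≤ x_4^(1), x_1^(1) ≤ x_5^(1), x_5^(1) ≤ x_7^(1)}. Then {x ∈ c_Z : x_1^(1) = x_2^(1) or x_1^(1) = x_3^(1) or x_3^(1) = x_4^(1) or x_3^(1) = x_5^(1) or x_5^(1) = x_7^(1)} ∩ M_d^(3)(n) = ((c_K ∩ c_Y) ∪ (c_X ∩ c_M) ∪ c_P) ∩ M_d^(3)(n). -/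
/-- The linear cell `c_Z = {x : x_5 = x_6, p_1(x_i) = p_1(x_j) for all i,j ∈ {1,…,7},
x_1^(1) ≤ x_2^(1), x_1^(1) ≤ x_3^(1), x_3^(1) ≤ x_4^(1), x_3^(1) ≤ x_5^(1),
x_5^(1) ≤ x_7^(1)}`. -/
def cellZ (d n : ℕ) [NeZero d] [NeZero n] : Set (Fin n → Fin d → ℝ) :=
  {x | x 4 = x 5 ∧
    (∀ i j : Fin n, i.val < 7 → j.val < 7 → ∀ a : Fin d, a ≠ 0 → x i a = x j a) ∧
    x 0 0 ≤ x 1 0 ∧ x 0 0 ≤ x 2 0 ∧ x 2 0 ≤ x 3 0 ∧ x 2 0 ≤ x 4 0 ∧ x 4 0 ≤ x 6 0}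

/-- The linear cell `c_P = {x : x_1 = x_3, x_5 = x_6, p_1(x_i) = p_1(x_j) for all
i,j ∈ {1,…,7}, x_1^(1) ≤ x_2^(1), x_1^(1) ≤ x_4^(1), x_1^(1) ≤ x_5^(1),
x_5^(1) ≤ x_7^(1)}`. -/
def cellP (d n : ℕ) [NeZero d] [NeZero n] : Set (Fin n → Fin d → ℝ) :=
  {x | x 0 = x 2 ∧ x 4 = x 5 ∧
    (∀ i j : Fin n, i.val < 7 → j.val < 7 → ∀ a : Fin d, a ≠ 0 → x i a = x j a) ∧
    x 0 0 ≤ x 1 0 ∧ x 0 0 ≤ x 3 0 ∧ x 0 0 ≤ x 4 0 ∧ x 4 0 ≤ x 6 0}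

/-- A point of the non-3-equal manifold has no three equal entries. -/
theorem not_three_equal {d n : ℕ} {x : Fin n → Fin d → ℝ} (hx : x ∈ nonKEqual d 3 n)
    {i j k : Fin n} (hij : i ≠ j) (hik : i ≠ k) (hjk : j ≠ k) (h : x i = x j) (h' : x i = x k) :
    False := by
  obtain ⟨a, ha, b, hb, hab⟩ := hx {i, j, k} (Finset.card_eq_three.mpr
    ⟨i, j, k, hij, hik, hjk, rfl⟩)
  simp only [Finset.mem_insert, Finset.mem_singleton] at ha hb
  grind

/-- Two vectors agree if their first coordinates and their remaining coordinates agree. -/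
theorem eq_of_first_of_rest {d : ℕ} [NeZero d] {u v : Fin d → ℝ} (h : u 0 = v 0)
    (h' : ∀ a : Fin d, a ≠ 0 → u a = v a) : u = v := by
  funext a
  by_cases ha : a = 0
  · rw [ha, h]
  · exact h' a ha

/-- within `M_d^(3)(n)`, the boundary of the cell `c_Z` consists exactly of
`(c_K ∩ c_Y) ∪ (c_X ∩ c_M)` together with the cell `c_P`. -/
theorem boundary_cellZ_eq (d n : ℕ) [NeZero d] [NeZero n] (hd : 2 ≤ d) (hn : 7 ≤ n) :
    {x ∈ cellZ d n | x 0 0 = x 1 0 ∨ x 0 0 = x 2 0 ∨ x 2 0 = x 3 0 ∨ x 2 0 = x 4 0 ∨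
      x 4 0 = x 6 0} ∩ nonKEqual d 3 n =
    ((cellK d n ∩ cellY d n) ∪ (cellX d n ∩ cellM d n) ∪ cellP d n) ∩ nonKEqual d 3 n := by
  have v0 : (0 : Fin n).val = 0 := Nat.zero_mod n
  have v1 : (1 : Fin n).val = 1 := Nat.mod_eq_of_lt (show 1 < n by omega)
  have v2 : (2 : Fin n).val = 2 := Nat.mod_eq_of_lt (show 2 < n by omega)
  have v3 : (3 : Fin n).val = 3 := Nat.mod_eq_of_lt (show 3 < n by omega)
  have v4 : (4 : Fin n).val = 4 := Nat.mod_eq_of_lt (show 4 < n by omega)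
  have v5 : (5 : Fin n).val = 5 := Nat.mod_eq_of_lt (show 5 < n by omega)
  have v6 : (6 : Fin n).val = 6 := Nat.mod_eq_of_lt (show 6 < n by omega)
  ext x
  refine and_congr_left fun hx => ⟨?_, ?_⟩
  · rintro ⟨⟨h45, hp, h01, h02, h23, h24, h46⟩, h⟩
    have hp' : ∀ i j : Fin n, i.val < 7 → j.val < 7 → x i 0 = x j 0 → x i = x j :=
      fun i j hi hj h => eq_of_first_of_rest h (hp i j hi hj)
    rcases h with h | h | h | h | h
    · exact Or.inl (Or.inl ⟨⟨hp' 0 1 (by omega) (by omega) h, hp 0 2 (by omega) (by omega), h02⟩,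
        h45, fun i j _ hi _ hj => hp i j hi hj, h23, h24, h46⟩)
    · exact Or.inr ⟨hp' 0 2 (by omega) (by omega) h, h45, hp, h01, h.trans_le h23,
        h.trans_le h24, h46⟩
    · exact Or.inl (Or.inr ⟨⟨hp' 2 3 (by omega) (by omega) h,
        fun i j hi hj => hp i j (by omega) (by omega), h01, h02, h24⟩,
        h45, hp 4 6 (by omega) (by omega), h46⟩)
    · exact (not_three_equal hx (i := 4) (j := 5) (k := 2) (Fin.ne_of_val_ne (by omega))
        (Fin.ne_of_val_ne (by omega)) (Fin.ne_of_val_ne (by omega)) h45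
        (hp' 4 2 (by omega) (by omega) h.symm)).elim
    · exact (not_three_equal hx (i := 4) (j := 5) (k := 6) (Fin.ne_of_val_ne (by omega))
        (Fin.ne_of_val_ne (by omega)) (Fin.ne_of_val_ne (by omega)) h45
        (hp' 4 6 (by omega) (by omega) h)).elim
  · rintro ((⟨⟨h01, hp02, h02⟩, h45, hp, h23, h24, h46⟩ |
      ⟨⟨h23, hp, h01, h02, h24⟩, h45, hp46, h46⟩) | ⟨h02, h45, hp, h01, h03, h04, h46⟩)
    · have key : ∀ i : Fin n, i.val < 7 → ∀ a : Fin d, a ≠ 0 → x i a = x 2 a := by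
        intro i hi a ha
        by_cases hi2 : 2 ≤ i.val
        · exact hp i 2 hi2 hi (by omega) (by omega) a ha
        · obtain rfl | rfl : i = 0 ∨ i = 1 := by
            rw [Fin.ext_iff, Fin.ext_iff]; omega
          · exact hp02 a ha
          · rw [← h01]; exact hp02 a ha
      exact ⟨⟨h45, fun i j hi hj a ha => (key i hi a ha).trans (key j hj a ha).symm,
        (congrFun h01 0).le, h02, h23, h24, h46⟩, Or.inl (congrFun h01 0)⟩
    · have key : ∀ i : Fin n, i.val < 7 → ∀ a : Fin d, a ≠ 0 → x i a = x 4 a := by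
        intro i hi a ha
        by_cases hi5 : i.val < 5
        · exact hp i 4 hi5 (by omega) a ha
        · obtain rfl | rfl : i = 5 ∨ i = 6 := by
            rw [Fin.ext_iff, Fin.ext_iff]; omega
          · rw [h45]
          · exact (hp46 a ha).symm
      exact ⟨⟨h45, fun i j hi hj a ha => (key i hi a ha).trans (key j hj a ha).symm,
        h01, h02, (congrFun h23 0).le, h24, h46⟩, Or.inr (Or.inr (Or.inl (congrFun h23 0)))⟩
    · have h := congrFun h02 0
      exact ⟨⟨h45, hp, h01, h.le, h.symm.trans_le h03, h.symm.trans_le h04, h46⟩,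
        Or.inr (Or.inl h)⟩
end

section
/- Let d ≥ 2 and n ≥ 6, and in (ℝ^d)^n set c_U = {x : x_1 = x_2, p_1(x_1) = p_1(x_3), p_1(x_1) = p_1(x_4), x_1^(1) ≤ x_3^(1), x_1^(1) ≤ x_4^(1)} and c_V = {x : x_5 = x_6, p_1(x_5) = p_1(x_3), p_1(x_5) = p_1(x_4), x_5^(1) ≤ x_3^(1), x_5^(1) ≤ x_4^(1)}. Then for every ε > 0 there exists a vector t ∈ (ℝ^d)^n with ‖t‖ < ε such that c_U ∩ (t + c_V) = ∅, where t + c_V = {t + y : y ∈ c_V}. -/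
/-- The linear cell `c_U = {x : x_1 = x_2, p_1(x_1) = p_1(x_3), p_1(x_1) = p_1(x_4),
x_1^(1) ≤ x_3^(1), x_1^(1) ≤ x_4^(1)}` (indices shifted to `0,…,n−1`). -/
def cellU (d n : ℕ) [NeZero d] [NeZero n] : Set (Fin n → Fin d → ℝ) :=
  {x | x 0 = x 1 ∧ (∀ a : Fin d, a ≠ 0 → x 0 a = x 2 a) ∧
    (∀ a : Fin d, a ≠ 0 → x 0 a = x 3 a) ∧ x 0 0 ≤ x 2 0 ∧ x 0 0 ≤ x 3 0}

/-- The linear cell `c_V = {x : x_5 = x_6, p_1(x_5) = p_1(x_3), p_1(x_5) = p_1(x_4),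
x_5^(1) ≤ x_3^(1), x_5^(1) ≤ x_4^(1)}`. -/
def cellV (d n : ℕ) [NeZero d] [NeZero n] : Set (Fin n → Fin d → ℝ) :=
  {x | x 4 = x 5 ∧ (∀ a : Fin d, a ≠ 0 → x 4 a = x 2 a) ∧
    (∀ a : Fin d, a ≠ 0 → x 4 a = x 3 a) ∧ x 4 0 ≤ x 2 0 ∧ x 4 0 ≤ x 3 0}

/-- general position: for every `ε > 0` there is a translation vector `t` with
`‖t‖ < ε` such that `c_U ∩ (t + c_V) = ∅`. -/
theorem cellU_cellV_general_position (d n : ℕ) [NeZero d] [NeZero n]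
    (hd : 2 ≤ d) (hn : 6 ≤ n) :
    ∀ ε : ℝ, 0 < ε → ∃ t : Fin n → Fin d → ℝ, ‖t‖ < ε ∧
      cellU d n ∩ ((fun y => t + y) '' cellV d n) = ∅ := by
  intro ε hε
  have ha : (⟨1, hd⟩ : Fin d) ≠ 0 := by
    simp [Fin.ext_iff]
  have h32 : (3 : Fin n) ≠ 2 := by
    intro h
    have h' : 3 % n = 2 % n := congrArg Fin.val h
    rw [Nat.mod_eq_of_lt (by omega), Nat.mod_eq_of_lt (by omega)] at h'
    omega
  refine ⟨Pi.single 2 (Pi.single ⟨1, hd⟩ (ε / 2)), ?_, ?_⟩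
  · rw [Pi.norm_single, Pi.norm_single, Real.norm_of_nonneg (by positivity)]
    exact half_lt_self hε
  · rw [Set.eq_empty_iff_forall_notMem]
    rintro _ ⟨⟨-, hx2, hx3, -⟩, y, ⟨-, hy2, hy3, -⟩, rfl⟩
    have hx := (hx2 _ ha).symm.trans (hx3 _ ha)
    have hy := (hy2 _ ha).symm.trans (hy3 _ ha)
    simp only [Pi.add_apply, Pi.single_eq_same, Pi.single_eq_of_ne h32, Pi.zero_apply] at hx
    linarith
end
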